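/- arXiv:1909.02187 — 3 statements merged into one kernel-verified Lean document; each statement's English description precedes it below -/
import Mathlib

section
/- Let K, T, S be positive integers with S ≤ T, let η > 0, and let ℓ_1, …, ℓ_T ∈ [0,1]^K. Define w_1 = (1/K, …, 1/K), and for each t ∈ {1,…,T} let w_{t+1} be the minimizer over the clipped simplex Δ̃_K of the function w ↦ ⟨w, ηℓ_t⟩ + D_φ(w‖w_t). Then for every comparator sequence (E_1,…,E_T) ∈ [K]^T with at most S−1 switches, ∑_{t=1}^T ⟨w_t, ℓ_t⟩ − ∑_{t=1}^T ℓ_t[E_t] ≤ ηT + (S·log(KT/S))/η + S. -/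
open Finset

/-- The probability simplex in `ℝ^K`. -/
def stdSimplex' (K : ℕ) : Set (Fin K → ℝ) :=
  {w | (∀ i, 0 ≤ w i) ∧ ∑ i, w i = 1}

/-- The clipped simplex `Δ̃_K = {w ∈ Δ_K : w i ≥ S/(TK)}`. -/
def clippedSimplex (K T S : ℕ) : Set (Fin K → ℝ) :=
  {w | w ∈ stdSimplex' K ∧ ∀ i, (S : ℝ) / (T * K) ≤ w i}

/-- The negative Shannon entropy `φ(w) = ∑ i, w i * log (w i)`. -/
noncomputable def negEntropy {K : ℕ} (w : Fin K → ℝ) : ℝ :=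
  ∑ i, w i * Real.log (w i)

/-- The Bregman divergence with respect to the negative Shannon entropy. -/
noncomputable def breg {K : ℕ} (x y : Fin K → ℝ) : ℝ :=
  negEntropy x - negEntropy y - ∑ i, (x i - y i) * (1 + Real.log (y i))

/-- The standard inner product on `ℝ^K`. -/
def ip {K : ℕ} (x y : Fin K → ℝ) : ℝ := ∑ i, x i * y i

/-- On the probability simplex the Bregman divergence of the negative entropy is the relative
entropy. -/
lemma breg_eq_sum {K : ℕ} {x y : Fin K → ℝ} (hx : x ∈ stdSimplex' K) (hy : y ∈ stdSimplex' K) :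
    breg x y = ∑ i, x i * (Real.log (x i) - Real.log (y i)) := by
  have h : ∑ i, (x i - y i) = 0 := by rw [Finset.sum_sub_distrib, hx.2, hy.2, sub_self]
  have : breg x y = ∑ i, x i * (Real.log (x i) - Real.log (y i)) - ∑ i, (x i - y i) := by
    simp only [breg, negEntropy, ← Finset.sum_sub_distrib]
    exact Finset.sum_congr rfl fun i _ => by ring
  rw [this, h, sub_zero]

/-- The relative entropy integrand is bounded by the chi-square integrand. -/
lemma mul_log_sub_le_sq_div {x y : ℝ} (hx : 0 < x) (hy : 0 < y) :
    x * (Real.log x - Real.log y) ≤ (x - y) + (x - y) ^ 2 / y := by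
  rw [← Real.log_div hx.ne' hy.ne']
  have h := Real.log_le_sub_one_of_pos (div_pos hx hy)
  calc x * Real.log (x / y) ≤ x * (x / y - 1) := by gcongr
    _ = _ := by field_simp; ring

/-- If `b * s + c * s ^ 2` is nonnegative for all small `s > 0`, then `b` is nonnegative. -/
lemma nonneg_of_forall_linear_add_sq {b c : ℝ}
    (h : ∀ s : ℝ, 0 < s → s ≤ 1 → 0 ≤ s * b + s ^ 2 * c) : 0 ≤ b := by
  by_contra! hb
  have hd : 0 < |c| - b := by linarith [abs_nonneg c]
  set s := -b / (2 * (|c| - b)) with hs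
  have hs0 : 0 < s := div_pos (by linarith) (by linarith)
  have hs1 : s ≤ 1 := by
    rw [hs, div_le_one (by linarith)]; linarith [abs_nonneg c]
  have h1 := h s hs0 hs1
  have h2 : 0 ≤ b + s * c := by
    by_contra! hn
    nlinarith [mul_pos_of_neg_of_neg hn (neg_lt_zero.mpr hs0)]
  have h3 : s * c ≤ s * (|c| - b) := by
    gcongr; linarith [le_abs_self c]
  have h4 : s * (|c| - b) = -b / 2 := by rw [hs]; field_simp
  linarith

/-- First-order optimality for the entropic proximal step over a convex set of positive
distributions. -/
lemma sum_sub_mul_grad_nonneg_of_isMin {K : ℕ} {C : Set (Fin K → ℝ)} (hC : Convex ℝ C)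
    (hCs : C ⊆ stdSimplex' K) (hCpos : ∀ v ∈ C, ∀ i, 0 < v i) {a y x u : Fin K → ℝ}
    (hy : y ∈ stdSimplex' K) (hx : x ∈ C) (hu : u ∈ C)
    (hmin : ∀ v ∈ C, ip x a + breg x y ≤ ip v a + breg v y) :
    0 ≤ ∑ i, (u i - x i) * (a i + Real.log (x i) - Real.log (y i)) := by
  apply nonneg_of_forall_linear_add_sq (c := ∑ i, (u i - x i) ^ 2 / x i)
  intro s hs0 hs1
  have hv : (1 - s) • x + s • u ∈ C := hC hx hu (by linarith) hs0.le (by ring)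
  set v := (1 - s) • x + s • u with hvdef
  have hvi : ∀ i, v i = x i + s * (u i - x i) := fun i => by
    simp only [hvdef, Pi.add_apply, Pi.smul_apply, smul_eq_mul]; ring
  have hm := hmin v hv
  rw [breg_eq_sum (hCs hx) hy, breg_eq_sum (hCs hv) hy] at hm
  have hsum : ∑ i, (v i - x i) = 0 := by
    rw [Finset.sum_sub_distrib, (hCs hv).2, (hCs hx).2, sub_self]
  have hle : ∑ i, v i * (Real.log (v i) - Real.log (x i)) ≤
      ∑ i, ((v i - x i) + (v i - x i) ^ 2 / x i) :=
    Finset.sum_le_sum fun i _ => mul_log_sub_le_sq_div (hCpos v hv i) (hCpos x hx i)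
  rw [Finset.sum_add_distrib, hsum, zero_add] at hle
  have hsq : ∑ i, (v i - x i) ^ 2 / x i = s ^ 2 * ∑ i, (u i - x i) ^ 2 / x i := by
    rw [Finset.mul_sum]
    exact Finset.sum_congr rfl fun i _ => by rw [hvi]; ring
  have hlin : s * ∑ i, (u i - x i) * (a i + Real.log (x i) - Real.log (y i)) =
      ip v a + ∑ i, v i * (Real.log (v i) - Real.log (y i))
        - (ip x a + ∑ i, x i * (Real.log (x i) - Real.log (y i)))
        - ∑ i, v i * (Real.log (v i) - Real.log (x i)) := by
    simp only [ip, Finset.mul_sum, ← Finset.sum_add_distrib, ← Finset.sum_sub_distrib]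
    refine Finset.sum_congr rfl fun i _ => ?_
    have : s * (u i - x i) = v i - x i := by rw [hvi]; ring
    rw [← mul_assoc, this]; ring
  linarith

/-- Local stability of the entropic proximal step, coordinatewise. -/
lemma sub_mul_sub_mul_log_le {x y a : ℝ} (hx : 0 < x) (hy : 0 < y) (ha : 0 ≤ a) :
    (y - x) * a - x * (Real.log x - Real.log y) ≤ y * a ^ 2 + (y - x) := by
  have hexp : Real.exp (-a) ≤ 1 - a + a ^ 2 := by
    rw [Real.exp_neg]
    have h1 : (Real.exp a)⁻¹ ≤ (1 + a)⁻¹ :=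
      inv_anti₀ (by linarith) (by linarith [Real.add_one_le_exp a])
    refine h1.trans ?_
    rw [inv_le_iff_one_le_mul₀ (by linarith)]
    nlinarith [pow_nonneg ha 3]
  have hz : 0 < y * Real.exp (-a) / x := by positivity
  have hlog := Real.log_le_sub_one_of_pos hz
  rw [Real.log_div (by positivity) hx.ne', Real.log_mul hy.ne' (by positivity), Real.log_exp]
    at hlog
  have h2 := mul_le_mul_of_nonneg_left hlog hx.le
  have h3 : x * (y * Real.exp (-a) / x - 1) = y * Real.exp (-a) - x := by field_simp
  have h4 := mul_le_mul_of_nonneg_left hexp hy.le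
  rw [h3] at h2
  nlinarith

/-- One-step regret bound for the entropic proximal step. -/
lemma ip_sub_ip_le_of_isMin {K : ℕ} {C : Set (Fin K → ℝ)} (hC : Convex ℝ C)
    (hCs : C ⊆ stdSimplex' K) (hCpos : ∀ v ∈ C, ∀ i, 0 < v i) {l y x u : Fin K → ℝ} {η : ℝ}
    (hη : 0 < η) (hl : ∀ i, l i ∈ Set.Icc (0 : ℝ) 1)
    (hy : y ∈ C) (hx : x ∈ C) (hu : u ∈ C)
    (hmin : ∀ v ∈ C, ip x (η • l) + breg x y ≤ ip v (η • l) + breg v y) :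
    η * (ip y l - ip u l) ≤ η ^ 2 + ∑ i, u i * (Real.log (x i) - Real.log (y i)) := by
  have hopt := sum_sub_mul_grad_nonneg_of_isMin hC hCs hCpos (hCs hy) hx hu hmin
  have hst : ∑ i, ((y i - x i) * (η * l i) - x i * (Real.log (x i) - Real.log (y i))) ≤
      ∑ i, (y i * η ^ 2 + (y i - x i)) := by
    refine Finset.sum_le_sum fun i _ => ?_
    refine (sub_mul_sub_mul_log_le (hCpos x hx i) (hCpos y hy i)
      (mul_nonneg hη.le (hl i).1)).trans ?_
    have hyi := hCpos y hy i
    have : η * l i ≤ η := mul_le_of_le_one_right hη.le (hl i).2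
    have := mul_nonneg hη.le (hl i).1
    gcongr
  have hsum : ∑ i, (y i * η ^ 2 + (y i - x i)) = η ^ 2 := by
    rw [Finset.sum_add_distrib, Finset.sum_sub_distrib, ← Finset.sum_mul, (hCs hy).2, (hCs hx).2]
    ring
  have hid : η * (ip y l - ip u l) =
      ∑ i, ((y i - x i) * (η * l i) - x i * (Real.log (x i) - Real.log (y i)))
        + ∑ i, u i * (Real.log (x i) - Real.log (y i))
        - ∑ i, (u i - x i) * ((η • l) i + Real.log (x i) - Real.log (y i)) := by
    simp only [ip, ← Finset.sum_add_distrib, ← Finset.sum_sub_distrib, Finset.mul_sum,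
      Pi.smul_apply, smul_eq_mul]
    exact Finset.sum_congr rfl fun i _ => by ring
  linarith

lemma convex_clippedSimplex (K T S : ℕ) : Convex ℝ (clippedSimplex K T S) := by
  intro x hx y hy a b ha hb hab
  refine ⟨⟨fun i => ?_, ?_⟩, fun i => ?_⟩
  · have h1 := hx.1.1 i
    have h2 := hy.1.1 i
    simp only [Pi.add_apply, Pi.smul_apply, smul_eq_mul]
    positivity
  · simp only [Pi.add_apply, Pi.smul_apply, smul_eq_mul, Finset.sum_add_distrib, ← Finset.mul_sum,
      hx.1.2, hy.1.2, mul_one, hab]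
  · simp only [Pi.add_apply, Pi.smul_apply, smul_eq_mul]
    calc (S : ℝ) / (T * K) = a * (S / (T * K)) + b * (S / (T * K)) := by
          rw [← add_mul, hab, one_mul]
      _ ≤ _ := add_le_add (mul_le_mul_of_nonneg_left (hx.2 i) ha)
          (mul_le_mul_of_nonneg_left (hy.2 i) hb)

/-- The point mass at `e` mixed with the uniform distribution with weight `c`. -/
noncomputable def mixedVertex {K : ℕ} (c : ℝ) (e : Fin K) : Fin K → ℝ :=
  fun i => (1 - c) * (if i = e then 1 else 0) + c / K

lemma sum_mixedVertex_mul {K : ℕ} (c : ℝ) (e : Fin K) (f : Fin K → ℝ) :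
    ∑ i, mixedVertex c e i * f i = (1 - c) * f e + c / K * ∑ i, f i := by
  simp [mixedVertex, add_mul, Finset.sum_add_distrib, Finset.mul_sum]

lemma mixedVertex_mem_clippedSimplex {K T S : ℕ} (hK : 0 < K) (hT : 0 < T) (hST : S ≤ T)
    (e : Fin K) : mixedVertex ((S : ℝ) / T) e ∈ clippedSimplex K T S := by
  have hK' : (0 : ℝ) < K := by exact_mod_cast hK
  have hT' : (0 : ℝ) < T := by exact_mod_cast hT
  have hc : (S : ℝ) / T ≤ 1 := by
    rw [div_le_one hT']; exact_mod_cast hST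
  have hlow : ∀ i, (S : ℝ) / (T * K) ≤ mixedVertex ((S : ℝ) / T) e i := fun i => by
    rw [mixedVertex, ← div_div]
    have : 0 ≤ (1 - (S : ℝ) / T) * (if i = e then 1 else 0) :=
      mul_nonneg (by linarith) (by split_ifs <;> norm_num)
    linarith
  refine ⟨⟨fun i => le_trans (by positivity) (hlow i), ?_⟩, hlow⟩
  have := sum_mixedVertex_mul ((S : ℝ) / T) e fun _ => 1
  simp only [mul_one] at this
  rw [this]
  simp
  field_simp
  ring

/-- Summation by parts for slowly varying comparators. -/
lemma sum_mixedVertex_mul_sub_le {K : ℕ} {c M : ℝ} (hc0 : 0 ≤ c) (hc1 : c ≤ 1) (E : ℕ → Fin K)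
    (L : ℕ → Fin K → ℝ) {n : ℕ} (hn : 1 ≤ n)
    (hL : ∀ t ∈ Finset.Icc 1 n, ∀ i, L t i ∈ Set.Icc (-M) 0) :
    ∑ t ∈ Finset.Icc 1 n, ∑ i, mixedVertex c (E t) i * (L (t + 1) i - L t i) ≤
      ∑ i, mixedVertex c (E n) i * L (n + 1) i - ∑ i, mixedVertex c (E 1) i * L 1 i
        + ((Finset.Icc 2 n).filter fun t => E t ≠ E (t - 1)).card * M := by
  induction n, hn using Nat.le_induction with
  | base => simp [mul_sub, Finset.sum_sub_distrib]
  | succ n hn ih =>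
    have ih := ih fun t ht => hL t (Finset.Icc_subset_Icc_right n.le_succ ht)
    have hLn := hL (n + 1) (Finset.mem_Icc.mpr ⟨by omega, le_rfl⟩)
    rw [Finset.sum_Icc_succ_top (by omega), ← Finset.insert_Icc_right_eq_Icc_add_one (by omega),
      Finset.filter_insert]
    simp only [Nat.add_sub_cancel]
    simp only [sum_mixedVertex_mul, Finset.sum_sub_distrib] at ih ⊢
    split_ifs with h
    · rw [Finset.card_insert_of_notMem (by simp)]
      push_cast
      have h1 : (1 - c) * (L (n + 1) (E n) - L (n + 1) (E (n + 1))) ≤ 1 * M := by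
        have hM : 0 ≤ M := by linarith [(hLn (E n)).1, (hLn (E n)).2]
        have : L (n + 1) (E n) - L (n + 1) (E (n + 1)) ≤ M := by
          linarith [(hLn (E n)).2, (hLn (E (n + 1))).1]
        exact (mul_le_mul_of_nonneg_left this (by linarith)).trans
          (mul_le_mul_of_nonneg_right (by linarith) hM)
      linarith
    · rw [not_not] at h
      rw [h]
      linarith

theorem omd_clipped_tracking_regret
    (K T S : ℕ) (hK : 0 < K) (hT : 0 < T) (hS : 0 < S) (hST : S ≤ T)
    (η : ℝ) (hη : 0 < η)
    (ℓ : ℕ → Fin K → ℝ)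
    (hℓ : ∀ t ∈ Finset.Icc 1 T, ∀ i, ℓ t i ∈ Set.Icc (0 : ℝ) 1)
    (w : ℕ → Fin K → ℝ)
    (hw1 : w 1 = fun _ => (K : ℝ)⁻¹)
    (hmin : ∀ t ∈ Finset.Icc 1 T,
      w (t + 1) ∈ clippedSimplex K T S ∧
      ∀ v ∈ clippedSimplex K T S,
        ip (w (t + 1)) (η • ℓ t) + breg (w (t + 1)) (w t)
          ≤ ip v (η • ℓ t) + breg v (w t))
    (E : ℕ → Fin K)
    (hE : ((Finset.Icc 2 T).filter (fun t => E t ≠ E (t - 1))).card ≤ S - 1) :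
    ∑ t ∈ Finset.Icc 1 T, ip (w t) (ℓ t) - ∑ t ∈ Finset.Icc 1 T, ℓ t (E t)
      ≤ η * T + S * Real.log (K * T / S) / η + S := by
  have hK' : (0 : ℝ) < K := by exact_mod_cast hK
  have hT' : (0 : ℝ) < T := by exact_mod_cast hT
  have hS' : (0 : ℝ) < S := by exact_mod_cast hS
  have hST' : (S : ℝ) ≤ T := by exact_mod_cast hST
  have hc0 : 0 ≤ (S : ℝ) / T := by positivity
  have hc1 : (S : ℝ) / T ≤ 1 := by rwa [div_le_one hT']
  have hε : 0 < (S : ℝ) / (T * K) := by positivity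
  have hCs : clippedSimplex K T S ⊆ stdSimplex' K := fun v hv => hv.1
  have hCpos : ∀ v ∈ clippedSimplex K T S, ∀ i, 0 < v i := fun v hv i => hε.trans_le (hv.2 i)
  have hw : ∀ t ∈ Finset.Icc 1 (T + 1), w t ∈ clippedSimplex K T S := by
    intro t ht
    rw [Finset.mem_Icc] at ht
    obtain rfl | h := ht.1.eq_or_lt
    · rw [hw1]
      refine ⟨⟨fun i => by positivity, by simp [hK'.ne']⟩, fun i => ?_⟩
      change (S : ℝ) / (T * K) ≤ (K : ℝ)⁻¹
      rw [← div_div, inv_eq_one_div]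
      gcongr
    · obtain ⟨s, rfl⟩ : ∃ s, t = s + 1 := ⟨t - 1, by omega⟩
      exact (hmin s (Finset.mem_Icc.mpr (by omega))).1
  set M := Real.log (K * T / S) with hM
  have hlogε : Real.log ((S : ℝ) / (T * K)) = -M := by
    rw [hM, ← Real.log_inv, inv_div, mul_comm (T : ℝ)]
  have hL : ∀ t ∈ Finset.Icc 1 (T + 1), ∀ i, Real.log (w t i) ∈ Set.Icc (-M) 0 := by
    intro t ht i
    have hwt := hw t ht
    refine ⟨hlogε ▸ Real.log_le_log hε (hwt.2 i), Real.log_nonpos (hwt.1.1 i) ?_⟩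
    rw [← hwt.1.2]
    exact Finset.single_le_sum (fun j _ => hwt.1.1 j) (Finset.mem_univ i)
  have hlogK : Real.log K ≤ M := by
    apply Real.log_le_log hK'
    rw [le_div_iff₀ hS']
    gcongr
  have hM0 : 0 ≤ M := (Real.log_natCast_nonneg K).trans hlogK
  have htel : ∑ t ∈ Finset.Icc 1 T, ∑ i, mixedVertex ((S : ℝ) / T) (E t) i *
      (Real.log (w (t + 1) i) - Real.log (w t i)) ≤ S * M := by
    have h := sum_mixedVertex_mul_sub_le hc0 hc1 E (fun t i => Real.log (w t i)) (M := M) hT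
      fun t ht => hL t (Finset.Icc_subset_Icc_right T.le_succ ht)
    have hend : ∑ i, mixedVertex ((S : ℝ) / T) (E T) i * Real.log (w (T + 1) i) ≤ 0 :=
      Finset.sum_nonpos fun i _ => mul_nonpos_of_nonneg_of_nonpos
        ((mixedVertex_mem_clippedSimplex hK hT hST (E T)).1.1 i)
        (hL (T + 1) (Finset.mem_Icc.mpr (by omega)) i).2
    have hstart : ∑ i, mixedVertex ((S : ℝ) / T) (E 1) i * Real.log (w 1 i) = -Real.log K := by
      simp only [hw1, Real.log_inv, ← Finset.sum_mul,
        (mixedVertex_mem_clippedSimplex hK hT hST (E 1)).1.2, one_mul]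
    have hcard : (((Finset.Icc 2 T).filter fun t => E t ≠ E (t - 1)).card : ℝ) * M ≤
        (S - 1) * M := by
      gcongr
      rw [← Nat.cast_pred hS]
      exact_mod_cast hE
    rw [hstart] at h
    linarith
  have hstep : ∀ t ∈ Finset.Icc 1 T, ip (w t) (ℓ t) - ℓ t (E t) ≤
      η + (∑ i, mixedVertex ((S : ℝ) / T) (E t) i *
        (Real.log (w (t + 1) i) - Real.log (w t i))) / η + S / T := by
    intro t ht
    have ht' := Finset.mem_Icc.mp ht
    have h := ip_sub_ip_le_of_isMin (convex_clippedSimplex K T S) hCs hCpos hη (hℓ t ht)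
      (hw t (Finset.mem_Icc.mpr (by omega))) (hmin t ht).1
      (mixedVertex_mem_clippedSimplex hK hT hST (E t)) (hmin t ht).2
    have hmix : ip (mixedVertex ((S : ℝ) / T) (E t)) (ℓ t) - ℓ t (E t) ≤ S / T := by
      rw [ip, sum_mixedVertex_mul]
      have hsum : ∑ i, ℓ t i ≤ K := by
        simpa using Finset.sum_le_sum fun i (_ : i ∈ Finset.univ) => (hℓ t ht i).2
      have h1 : (S : ℝ) / T / K * ∑ i, ℓ t i ≤ S / T / K * K := by gcongr
      rw [div_mul_cancel₀ _ hK'.ne'] at h1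
      have h2 := mul_nonneg hc0 (hℓ t ht (E t)).1
      linarith
    rw [← le_div_iff₀' hη, add_div, pow_two, mul_div_cancel_right₀ _ hη.ne'] at h
    linarith
  rw [← Finset.sum_sub_distrib]
  refine (Finset.sum_le_sum hstep).trans ?_
  rw [Finset.sum_add_distrib, Finset.sum_add_distrib, ← Finset.sum_div]
  have hdiv := div_le_div_of_nonneg_right htel hη.le
  simp only [Finset.sum_const, Nat.card_Icc, Nat.add_sub_cancel, nsmul_eq_mul]
  rw [mul_div_cancel₀ _ hT'.ne']
  linarith
end

section
/- Let K, T, S be positive integers with S ≤ T, let η ∈ (0, 1/2], and let Z_1, …, Z_T be K×K real symmetric matrices with ‖Z_t‖_* ≤ 1 for all t. Let W_1 be any element of the clipped spectraplex Ω̃_K, and for each t ∈ {1,…,T} let W_{t+1} be the minimizer over Ω̃_K of W ↦ tr(−W·log(I − ηZ_t)) + D_ψ(W‖W_t). Then for every sequence (U_1,…,U_T) ∈ Ω_K^T with at most S−1 switches (i.e., ∑_{t=2}^T 1{U_t ≠ U_{t−1}} ≤ S−1), ∑_{t=1}^T tr(W_t Z_t) − ∑_{t=1}^T tr(U_t Z_t)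 ≤ η·∑_{t=1}^T tr(U_t Z_t²) + (S·log(KT/S))/η + 5S/2. -/
open Finset Matrix

/-- The matrix logarithm of a symmetric matrix, defined via the spectral
decomposition (and junk value `0` on non-Hermitian matrices). -/
noncomputable def matLog {K : ℕ} (A : Matrix (Fin K) (Fin K) ℝ) :
    Matrix (Fin K) (Fin K) ℝ :=
  if h : A.IsHermitian then
    (h.eigenvectorUnitary : Matrix (Fin K) (Fin K) ℝ) *
      Matrix.diagonal (fun i => Real.log (h.eigenvalues i)) *
      (star (h.eigenvectorUnitary : Matrix (Fin K) (Fin K) ℝ))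
  else 0

/-- The spectraplex: symmetric PSD matrices of trace 1. -/
def spectraplex (K : ℕ) : Set (Matrix (Fin K) (Fin K) ℝ) :=
  {W | W.PosSemidef ∧ W.trace = 1}

/-- The clipped spectraplex `Ω̃_K = {W ∈ Ω_K : λ_min(W) ≥ S/(TK)}`,
with the eigenvalue bound expressed in the Loewner order. -/
def clippedSpectraplex (K T S : ℕ) : Set (Matrix (Fin K) (Fin K) ℝ) :=
  {W | W.PosSemidef ∧ W.trace = 1 ∧
    (W - ((S : ℝ) / (T * K)) • (1 : Matrix (Fin K) (Fin K) ℝ)).PosSemidef}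

/-- The negative von Neumann entropy `ψ(W) = tr(W log W)`. -/
noncomputable def vnEntropy {K : ℕ} (W : Matrix (Fin K) (Fin K) ℝ) : ℝ :=
  (W * matLog W).trace

/-- The Bregman divergence with respect to the negative von Neumann entropy. -/
noncomputable def bregPsi {K : ℕ} (A B : Matrix (Fin K) (Fin K) ℝ) : ℝ :=
  vnEntropy A - vnEntropy B - ((A - B) * (1 + matLog B)).trace

/-- `‖Z‖_* ≤ 1` for a symmetric matrix `Z`: the spectral norm is at most one,
expressed as `-I ⪯ Z ⪯ I`. -/
def specNormLeOne {K : ℕ} (Z : Matrix (Fin K) (Fin K) ℝ) : Prop :=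
  Z.IsHermitian ∧ ((1 : Matrix (Fin K) (Fin K) ℝ) - Z).PosSemidef ∧
    ((1 : Matrix (Fin K) (Fin K) ℝ) + Z).PosSemidef

/-- The matrix `Q diag(d) Qᵀ`. -/
def rotDiag {K : ℕ} (Q : Matrix (Fin K) (Fin K) ℝ) (d : Fin K → ℝ) :
    Matrix (Fin K) (Fin K) ℝ :=
  Q * Matrix.diagonal d * Qᵀ

theorem Matrix.IsHermitian.exists_rotDiag {K : ℕ} {A : Matrix (Fin K) (Fin K) ℝ}
    (h : A.IsHermitian) :
    ∃ (Q : Matrix (Fin K) (Fin K) ℝ) (a : Fin K → ℝ), Q * Qᵀ = 1 ∧ Qᵀ * Q = 1 ∧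
      A = rotDiag Q a ∧ matLog A = rotDiag Q (fun i => Real.log (a i)) := by
  have hs : star (h.eigenvectorUnitary : Matrix (Fin K) (Fin K) ℝ)
      = (h.eigenvectorUnitary : Matrix (Fin K) (Fin K) ℝ)ᵀ := by
    rw [Matrix.star_eq_conjTranspose, Matrix.conjTranspose_eq_transpose_of_trivial]
  refine ⟨h.eigenvectorUnitary, h.eigenvalues, ?_, ?_, ?_, ?_⟩
  · rw [← hs]; exact Unitary.coe_mul_star_self _
  · rw [← hs]; exact Unitary.coe_star_mul_self _
  · have := h.spectral_theorem
    rw [Unitary.conjStarAlgAut_apply] at this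
    rw [rotDiag, ← hs]
    exact this
  · rw [matLog, dif_pos h, rotDiag, hs]

theorem rotDiag_one {K : ℕ} {Q : Matrix (Fin K) (Fin K) ℝ} (hQ : Q * Qᵀ = 1) :
    rotDiag Q (fun _ => 1) = 1 := by
  simp [rotDiag, hQ]

theorem rotDiag_mul {K : ℕ} {Q : Matrix (Fin K) (Fin K) ℝ} (hQ : Qᵀ * Q = 1)
    (x y : Fin K → ℝ) : rotDiag Q x * rotDiag Q y = rotDiag Q (fun i => x i * y i) := by
  have : rotDiag Q x * rotDiag Q y
      = Q * Matrix.diagonal x * (Qᵀ * Q) * Matrix.diagonal y * Qᵀ := by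
    simp only [rotDiag, Matrix.mul_assoc]
  rw [this, hQ, Matrix.mul_one, Matrix.mul_assoc Q, Matrix.diagonal_mul_diagonal, rotDiag]

theorem trace_rotDiag_mul_rotDiag {K : ℕ} (P Q : Matrix (Fin K) (Fin K) ℝ)
    (x y : Fin K → ℝ) :
    (rotDiag P x * rotDiag Q y).trace = ∑ i, ∑ j, x i * y j * ((Pᵀ * Q) i j) ^ 2 := by
  have h : (rotDiag P x * rotDiag Q y).trace
      = ((Matrix.diagonal x * (Pᵀ * Q)) * (Matrix.diagonal y * (Pᵀ * Q)ᵀ)).trace := by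
    rw [rotDiag, rotDiag, Matrix.mul_assoc P, Matrix.mul_assoc P, Matrix.trace_mul_comm]
    simp only [Matrix.transpose_mul, Matrix.transpose_transpose, Matrix.mul_assoc]
  rw [h, Matrix.trace]
  refine Finset.sum_congr rfl fun i _ => ?_
  rw [Matrix.diag_apply, Matrix.mul_apply]
  refine Finset.sum_congr rfl fun j _ => ?_
  rw [Matrix.diagonal_mul, Matrix.diagonal_mul, Matrix.transpose_apply]
  ring

theorem trace_rotDiag {K : ℕ} {Q : Matrix (Fin K) (Fin K) ℝ} (hQ : Qᵀ * Q = 1)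
    (x : Fin K → ℝ) : (rotDiag Q x).trace = ∑ i, x i := by
  rw [rotDiag, Matrix.trace_mul_comm, ← Matrix.mul_assoc, hQ, Matrix.one_mul,
    Matrix.trace_diagonal]

theorem rotDiag_conj {K : ℕ} {Q : Matrix (Fin K) (Fin K) ℝ} (hQ : Qᵀ * Q = 1)
    (x : Fin K → ℝ) : Qᵀ * rotDiag Q x * Q = Matrix.diagonal x := by
  have : Qᵀ * rotDiag Q x * Q = (Qᵀ * Q) * Matrix.diagonal x * (Qᵀ * Q) := by
    simp only [rotDiag, Matrix.mul_assoc]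
  rw [this, hQ, Matrix.one_mul, Matrix.mul_one]

theorem le_of_posSemidef_rotDiag_sub {K : ℕ} {Q : Matrix (Fin K) (Fin K) ℝ}
    (hQ : Qᵀ * Q = 1) {x : Fin K → ℝ} {c : ℝ}
    (h : (rotDiag Q x - c • (1 : Matrix (Fin K) (Fin K) ℝ)).PosSemidef) (i : Fin K) :
    c ≤ x i := by
  have h1 := (h.conjTranspose_mul_mul_same Q).diag_nonneg (i := i)
  rw [Matrix.conjTranspose_eq_transpose_of_trivial, Matrix.mul_sub, Matrix.sub_mul,
    rotDiag_conj hQ] at h1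
  simp [hQ] at h1
  exact h1

theorem sum_overlap_right {K : ℕ} {P Q : Matrix (Fin K) (Fin K) ℝ} (hP : Pᵀ * P = 1)
    (hQ : Q * Qᵀ = 1) (i : Fin K) : ∑ j, ((Pᵀ * Q) i j) ^ 2 = 1 := by
  have h : (Pᵀ * Q) * (Pᵀ * Q)ᵀ = 1 := by
    have : (Pᵀ * Q) * (Pᵀ * Q)ᵀ = Pᵀ * (Q * Qᵀ) * P := by
      simp only [Matrix.transpose_mul, Matrix.transpose_transpose, Matrix.mul_assoc]
    rw [this, hQ, Matrix.mul_one, hP]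
  have h2 := congrFun (congrFun h i) i
  rw [Matrix.mul_apply, Matrix.one_apply_eq] at h2
  rw [← h2]
  exact Finset.sum_congr rfl fun j _ => by rw [Matrix.transpose_apply, sq]

theorem sum_overlap_left {K : ℕ} {P Q : Matrix (Fin K) (Fin K) ℝ} (hP : P * Pᵀ = 1)
    (hQ : Qᵀ * Q = 1) (j : Fin K) : ∑ i, ((Pᵀ * Q) i j) ^ 2 = 1 := by
  rw [← sum_overlap_right (P := Q) (Q := P) hQ hP j]
  refine Finset.sum_congr rfl fun i _ => ?_
  rw [← Matrix.transpose_apply (Qᵀ * P), Matrix.transpose_mul, Matrix.transpose_transpose]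

/-- The variational inequality behind the comparison of quantum and measured relative entropy. -/
theorem sum_sq_div_le {K : ℕ} {P Q R : Matrix (Fin K) (Fin K) ℝ}
    (hP : P * Pᵀ = 1) (hQ : Q * Qᵀ = 1) (hR' : Rᵀ * R = 1)
    {a w : Fin K → ℝ} (ha : ∀ i, 0 < a i) (hw : ∀ i, 0 < w i)
    {p q : Fin K → ℝ} (hp : ∀ k, 0 < p k) (hq : ∀ k, 0 < q k)
    (hpW : ∀ k, p k = ∑ j, w j * ((Rᵀ * Q) k j) ^ 2)
    (hqA : ∀ k, q k = ∑ j, a j * ((Rᵀ * P) k j) ^ 2) {t : ℝ} (ht : 0 ≤ t) :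
    ∑ k, p k ^ 2 / (q k + t * p k)
      ≤ ∑ i, ∑ j, w j ^ 2 / (a i + t * w j) * ((Pᵀ * Q) i j) ^ 2 := by
  set y : Fin K → ℝ := fun k => p k / (q k + t * p k) with hy
  have hden : ∀ k, 0 < q k + t * p k := fun k => by
    have := hp k; have := hq k; positivity
  have key : ∀ (z : Fin K → ℝ) (A : Matrix (Fin K) (Fin K) ℝ) (b : Fin K → ℝ),
      (rotDiag R z * rotDiag A b).trace = ∑ k, z k * ∑ j, b j * ((Rᵀ * A) k j) ^ 2 := by
    intro z A b
    rw [trace_rotDiag_mul_rotDiag]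
    refine Finset.sum_congr rfl fun k _ => ?_
    rw [Finset.mul_sum]
    exact Finset.sum_congr rfl fun j _ => by ring
  set Y := rotDiag R y with hY
  have hYt : Yᵀ = Y := by
    simp [hY, rotDiag, Matrix.transpose_mul, Matrix.mul_assoc]
  set E := Pᵀ * Y * Q with hE
  set O := Pᵀ * Q with hO
  have e1 : ∑ i, ∑ j, w j * (O i j * E i j) = ∑ k, y k * p k := by
    have h1 : (Y * rotDiag Q w).trace = ∑ k, y k * p k := by
      rw [hY, key]; simp only [hpW]
    have h2 : (Y * rotDiag Q w).trace = (Oᵀ * (E * Matrix.diagonal w)).trace := by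
      have : Oᵀ * (E * Matrix.diagonal w) = Qᵀ * ((P * Pᵀ) * (Y * (Q * Matrix.diagonal w))) := by
        simp only [hO, hE, Matrix.transpose_mul, Matrix.transpose_transpose, Matrix.mul_assoc]
      rw [this, hP, Matrix.one_mul, Matrix.trace_mul_comm Qᵀ, rotDiag]
      simp only [Matrix.mul_assoc]
    rw [← h1, h2, Matrix.trace, Finset.sum_comm]
    refine Finset.sum_congr rfl fun j _ => ?_
    rw [Matrix.diag_apply, Matrix.mul_apply]
    refine Finset.sum_congr rfl fun i _ => ?_
    rw [Matrix.mul_diagonal, Matrix.transpose_apply]; ring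
  have hYY : Y * Y = rotDiag R (fun k => y k * y k) := by rw [hY, rotDiag_mul hR']
  have e2 : ∑ i, ∑ j, a i * E i j ^ 2 = ∑ k, y k ^ 2 * q k := by
    have h1 : (Y * Y * rotDiag P a).trace = ∑ k, y k ^ 2 * q k := by
      rw [hYY, key]; simp only [hqA, sq]
    have h2 : (Y * Y * rotDiag P a).trace = ((Matrix.diagonal a * E) * Eᵀ).trace := by
      have : (Matrix.diagonal a * E) * Eᵀ
          = (Matrix.diagonal a * Pᵀ) * (Y * ((Q * Qᵀ) * (Y * P))) := by
        simp only [hE, Matrix.transpose_mul, Matrix.transpose_transpose, hYt, Matrix.mul_assoc]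
      rw [this, hQ, Matrix.one_mul, Matrix.trace_mul_comm (Matrix.diagonal a * Pᵀ), rotDiag]
      have h3 : Y * (Y * P) * (Matrix.diagonal a * Pᵀ) = Y * Y * (P * Matrix.diagonal a * Pᵀ) := by
        simp only [Matrix.mul_assoc]
      rw [h3]
    rw [← h1, h2, Matrix.trace]
    refine Finset.sum_congr rfl fun i _ => ?_
    rw [Matrix.diag_apply, Matrix.mul_apply]
    refine Finset.sum_congr rfl fun j _ => ?_
    rw [Matrix.diagonal_mul, Matrix.transpose_apply]; ring
  have e3 : ∑ i, ∑ j, w j * E i j ^ 2 = ∑ k, y k ^ 2 * p k := by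
    have h1 : (Y * Y * rotDiag Q w).trace = ∑ k, y k ^ 2 * p k := by
      rw [hYY, key]; simp only [hpW, sq]
    have h2 : (Y * Y * rotDiag Q w).trace = (Eᵀ * (E * Matrix.diagonal w)).trace := by
      have : Eᵀ * (E * Matrix.diagonal w)
          = Qᵀ * (Y * ((P * Pᵀ) * (Y * (Q * Matrix.diagonal w)))) := by
        simp only [hE, Matrix.transpose_mul, Matrix.transpose_transpose, hYt, Matrix.mul_assoc]
      rw [this, hP, Matrix.one_mul, Matrix.trace_mul_comm Qᵀ, rotDiag]
      simp only [Matrix.mul_assoc]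
    rw [← h1, h2, Matrix.trace, Finset.sum_comm]
    refine Finset.sum_congr rfl fun j _ => ?_
    rw [Matrix.diag_apply, Matrix.mul_apply]
    refine Finset.sum_congr rfl fun i _ => ?_
    rw [Matrix.mul_diagonal, Matrix.transpose_apply]; ring
  have hle : ∑ i, ∑ j, (2 * (w j * (O i j * E i j)) - a i * E i j ^ 2 - t * (w j * E i j ^ 2))
      ≤ ∑ i, ∑ j, w j ^ 2 / (a i + t * w j) * O i j ^ 2 := by
    refine Finset.sum_le_sum fun i _ => Finset.sum_le_sum fun j _ => ?_
    have hd : 0 < a i + t * w j := by have := ha i; have := hw j; positivity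
    rw [div_mul_eq_mul_div, le_div_iff₀ hd]
    nlinarith [sq_nonneg (w j * O i j - E i j * (a i + t * w j))]
  refine le_trans (le_of_eq ?_) hle
  have hsplit : ∑ i, ∑ j, (2 * (w j * (O i j * E i j)) - a i * E i j ^ 2 - t * (w j * E i j ^ 2))
      = 2 * (∑ i, ∑ j, w j * (O i j * E i j)) - (∑ i, ∑ j, a i * E i j ^ 2)
        - t * ∑ i, ∑ j, w j * E i j ^ 2 := by
    simp only [Finset.sum_sub_distrib, Finset.mul_sum]
  rw [hsplit, e1, e2, e3, Finset.mul_sum, Finset.mul_sum, ← Finset.sum_sub_distrib,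
    ← Finset.sum_sub_distrib]
  refine Finset.sum_congr rfl fun k _ => ?_
  have hyk : y k * (q k + t * p k) = p k := div_mul_cancel₀ _ (hden k).ne'
  have hpy : p k ^ 2 / (q k + t * p k) = y k * p k := by simp only [hy]; ring
  rw [hpy]
  linear_combination y k * hyk

/-- Relative entropy does not increase under a measurement in an orthonormal basis. -/
theorem measured_relEntropy_le {K : ℕ} {P Q R : Matrix (Fin K) (Fin K) ℝ}
    (hP : P * Pᵀ = 1) (hQ : Q * Qᵀ = 1) (hQ' : Qᵀ * Q = 1)
    (hR : R * Rᵀ = 1) (hR' : Rᵀ * R = 1)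
    {a w : Fin K → ℝ} (ha : ∀ i, 0 < a i) (hw : ∀ i, 0 < w i)
    {p q : Fin K → ℝ} (hp : ∀ k, 0 < p k) (hq : ∀ k, 0 < q k)
    (hpW : ∀ k, p k = ∑ j, w j * ((Rᵀ * Q) k j) ^ 2)
    (hqA : ∀ k, q k = ∑ j, a j * ((Rᵀ * P) k j) ^ 2) :
    ∑ k, p k * (Real.log (p k) - Real.log (q k))
      ≤ ∑ i, ∑ j, w j * (Real.log (w j) - Real.log (a i)) * ((Pᵀ * Q) i j) ^ 2 := by
  set O := Pᵀ * Q with hO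
  set f : ℝ → ℝ := fun t => (∑ i, ∑ j, w j * O i j ^ 2 * Real.log (a i + t * w j))
    - ∑ k, p k * Real.log (q k + t * p k) with hf
  have hd1 : ∀ t, 0 ≤ t → ∀ i j, 0 < a i + t * w j := fun t ht i j => by
    have := ha i; have := hw j; positivity
  have hd2 : ∀ t, 0 ≤ t → ∀ k, 0 < q k + t * p k := fun t ht k => by
    have := hp k; have := hq k; positivity
  have hder : ∀ t, 0 ≤ t → HasDerivAt f ((∑ i, ∑ j, w j * O i j ^ 2 * (w j / (a i + t * w j)))
      - ∑ k, p k * (p k / (q k + t * p k))) t := by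
    intro t ht
    have hlog : ∀ c d : ℝ, 0 < c + t * d →
        HasDerivAt (fun s => Real.log (c + s * d)) (d / (c + t * d)) t := by
      intro c d hcd
      have : HasDerivAt (fun s : ℝ => c + s * d) d t := by
        simpa using ((hasDerivAt_id t).mul_const d).const_add c
      exact this.log hcd.ne'
    refine HasDerivAt.sub ?_ ?_
    · exact HasDerivAt.fun_sum fun i _ => HasDerivAt.fun_sum fun j _ =>
        (hlog _ _ (hd1 t ht i j)).const_mul _
    · exact HasDerivAt.fun_sum fun k _ => (hlog _ _ (hd2 t ht k)).const_mul _
  have hmono : MonotoneOn f (Set.Ici 0) := by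
    refine monotoneOn_of_deriv_nonneg (convex_Ici 0)
      (fun t ht => (hder t ht).continuousAt.continuousWithinAt)
      (fun t ht => (hder t (interior_subset ht)).differentiableAt.differentiableWithinAt) ?_
    intro t ht
    rw [(hder t (interior_subset ht)).deriv, sub_nonneg]
    refine le_trans (le_of_eq ?_) ((sum_sq_div_le hP hQ hR' ha hw hp hq hpW hqA
      (interior_subset ht)).trans (le_of_eq ?_))
    · exact Finset.sum_congr rfl fun k _ => by ring
    · exact Finset.sum_congr rfl fun i _ => Finset.sum_congr rfl fun j _ => by ring
  have hmass : ∑ i, ∑ j, w j * O i j ^ 2 = ∑ k, p k := by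
    have h1 : ∀ B : Matrix (Fin K) (Fin K) ℝ, B * Bᵀ = 1 →
        ∑ i, ∑ j, w j * ((Bᵀ * Q) i j) ^ 2 = ∑ j, w j := by
      intro B hB
      rw [Finset.sum_comm]
      refine Finset.sum_congr rfl fun j _ => ?_
      rw [← Finset.mul_sum, sum_overlap_left hB hQ', mul_one]
    rw [h1 P hP, ← h1 R hR]
    exact Finset.sum_congr rfl fun k _ => (hpW k).symm
  have hshift : ∀ t, 0 < t → f t = (∑ i, ∑ j, w j * O i j ^ 2 * Real.log (a i * t⁻¹ + w j))
      - ∑ k, p k * Real.log (q k * t⁻¹ + p k) := by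
    intro t ht
    have hl : ∀ c d : ℝ, 0 < c → 0 < d →
        Real.log (c + t * d) = Real.log t + Real.log (c * t⁻¹ + d) := by
      intro c d hc hd
      rw [← Real.log_mul ht.ne' (by positivity)]
      congr 1
      field_simp
    have h1 : ∀ i j, w j * O i j ^ 2 * Real.log (a i + t * w j)
        = w j * O i j ^ 2 * Real.log t + w j * O i j ^ 2 * Real.log (a i * t⁻¹ + w j) :=
      fun i j => by rw [hl _ _ (ha i) (hw j)]; ring
    have h2 : ∀ k, p k * Real.log (q k + t * p k)
        = p k * Real.log t + p k * Real.log (q k * t⁻¹ + p k) :=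
      fun k => by rw [hl _ _ (hq k) (hp k)]; ring
    simp only [hf, h1, h2, Finset.sum_add_distrib, ← Finset.sum_mul, hmass]
    ring
  have hlim : Filter.Tendsto f Filter.atTop (nhds ((∑ i, ∑ j, w j * O i j ^ 2 * Real.log (w j))
      - ∑ k, p k * Real.log (p k))) := by
    have hl : ∀ c d : ℝ, 0 < d →
        Filter.Tendsto (fun t : ℝ => Real.log (c * t⁻¹ + d)) Filter.atTop
          (nhds (Real.log d)) := by
      intro c d hd
      have : Filter.Tendsto (fun t : ℝ => c * t⁻¹ + d) Filter.atTop (nhds d) := by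
        simpa using (tendsto_inv_atTop_zero.const_mul c).add_const d
      exact this.log hd.ne'
    refine Filter.Tendsto.congr' (f₁ := fun t : ℝ =>
      (∑ i, ∑ j, w j * O i j ^ 2 * Real.log (a i * t⁻¹ + w j))
      - ∑ k, p k * Real.log (q k * t⁻¹ + p k)) ?_ ?_
    · filter_upwards [Filter.eventually_gt_atTop 0] with t ht
      exact (hshift t ht).symm
    · refine Filter.Tendsto.sub ?_ ?_
      · exact tendsto_finsetSum _ fun i _ => tendsto_finsetSum _ fun j _ =>
          (hl _ _ (hw j)).const_mul _
      · exact tendsto_finsetSum _ fun k _ => (hl _ _ (hp k)).const_mul _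
  have h0 : f 0 ≤ _ := ge_of_tendsto hlim (by
    filter_upwards [Filter.eventually_ge_atTop 0] with t ht
    exact hmono (Set.mem_Ici.2 le_rfl) ht ht)
  simp only [hf, zero_mul, add_zero] at h0
  have e1 : ∑ k, p k * (Real.log (p k) - Real.log (q k))
      = ∑ k, p k * Real.log (p k) - ∑ k, p k * Real.log (q k) := by
    rw [← Finset.sum_sub_distrib]; exact Finset.sum_congr rfl fun k _ => by ring
  have e2 : ∑ i, ∑ j, w j * (Real.log (w j) - Real.log (a i)) * O i j ^ 2
      = ∑ i, ∑ j, w j * O i j ^ 2 * Real.log (w j)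
        - ∑ i, ∑ j, w j * O i j ^ 2 * Real.log (a i) := by
    simp only [← Finset.sum_sub_distrib]
    exact Finset.sum_congr rfl fun i _ => Finset.sum_congr rfl fun j _ => by ring
  rw [e1, e2]
  linarith

theorem trace_rotDiag_eq_left {K : ℕ} {P Q : Matrix (Fin K) (Fin K) ℝ} (hP : Pᵀ * P = 1)
    (hQ : Q * Qᵀ = 1) (x : Fin K → ℝ) :
    (rotDiag P x).trace = ∑ i, ∑ j, x i * ((Pᵀ * Q) i j) ^ 2 := by
  rw [trace_rotDiag hP]
  refine Finset.sum_congr rfl fun i _ => ?_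
  rw [← Finset.mul_sum, sum_overlap_right hP hQ, mul_one]

theorem trace_rotDiag_eq_right {K : ℕ} {P Q : Matrix (Fin K) (Fin K) ℝ} (hP : P * Pᵀ = 1)
    (hQ : Qᵀ * Q = 1) (y : Fin K → ℝ) :
    (rotDiag Q y).trace = ∑ i, ∑ j, y j * ((Pᵀ * Q) i j) ^ 2 := by
  rw [trace_rotDiag hQ, Finset.sum_comm]
  refine Finset.sum_congr rfl fun j _ => ?_
  rw [← Finset.mul_sum, sum_overlap_left hP hQ, mul_one]

/-- `A ≥ c` in the Loewner order, together with a spectral decomposition of `A`. -/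
theorem exists_rotDiag_of_posSemidef_sub {K : ℕ} {A : Matrix (Fin K) (Fin K) ℝ}
    (hA : A.IsHermitian) {c : ℝ}
    (h : (A - c • (1 : Matrix (Fin K) (Fin K) ℝ)).PosSemidef) :
    ∃ (Q : Matrix (Fin K) (Fin K) ℝ) (a : Fin K → ℝ), Q * Qᵀ = 1 ∧ Qᵀ * Q = 1 ∧
      A = rotDiag Q a ∧ matLog A = rotDiag Q (fun i => Real.log (a i)) ∧ ∀ i, c ≤ a i := by
  obtain ⟨Q, a, h1, h2, h3, h4⟩ := hA.exists_rotDiag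
  refine ⟨Q, a, h1, h2, h3, h4, le_of_posSemidef_rotDiag_sub h2 ?_⟩
  rwa [← h3]

theorem bregPsi_eq {K : ℕ} (A B : Matrix (Fin K) (Fin K) ℝ) :
    bregPsi A B = (A * matLog A).trace - (A * matLog B).trace - A.trace + B.trace := by
  simp only [bregPsi, vnEntropy, Matrix.sub_mul, Matrix.mul_add, Matrix.mul_one,
    Matrix.trace_sub, Matrix.trace_add]
  ring

/-- The variational form of the Golden–Thompson inequality. -/
theorem trace_sub_trace_mul_le {K : ℕ} {W A M : Matrix (Fin K) (Fin K) ℝ}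
    (hW : W.IsHermitian) (hA : A.IsHermitian) (hM : M.IsHermitian)
    {c d : ℝ} (hc : 0 < c) (hd : 0 < d)
    (hWc : (W - c • (1 : Matrix (Fin K) (Fin K) ℝ)).PosSemidef)
    (hAc : (A - c • (1 : Matrix (Fin K) (Fin K) ℝ)).PosSemidef)
    (hMd : (M - d • (1 : Matrix (Fin K) (Fin K) ℝ)).PosSemidef) :
    W.trace - (A * M).trace
      ≤ (W * matLog W).trace - (W * matLog A).trace - (W * matLog M).trace := by
  obtain ⟨Q, w, hQ, hQ', rfl, hWl, hw⟩ := exists_rotDiag_of_posSemidef_sub hW hWc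
  obtain ⟨P, a, hP, hP', rfl, hAl, ha⟩ := exists_rotDiag_of_posSemidef_sub hA hAc
  obtain ⟨R, m, hR, hR', rfl, hMl, hm⟩ := exists_rotDiag_of_posSemidef_sub hM hMd
  have hpos : ∀ (B : Matrix (Fin K) (Fin K) ℝ) (b : Fin K → ℝ), B * Bᵀ = 1 →
      (∀ i, c ≤ b i) → ∀ k, 0 < ∑ j, b j * ((Rᵀ * B) k j) ^ 2 := by
    intro B b hB hb k
    calc 0 < c * 1 := by simpa using hc
      _ = ∑ j, c * ((Rᵀ * B) k j) ^ 2 := by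
        rw [← Finset.mul_sum, sum_overlap_right hR' hB]
      _ ≤ _ := Finset.sum_le_sum fun j _ => mul_le_mul_of_nonneg_right (hb j) (sq_nonneg _)
  set p : Fin K → ℝ := fun k => ∑ j, w j * ((Rᵀ * Q) k j) ^ 2 with hp
  set q : Fin K → ℝ := fun k => ∑ j, a j * ((Rᵀ * P) k j) ^ 2 with hq
  have hp0 : ∀ k, 0 < p k := hpos Q w hQ hw
  have hq0 : ∀ k, 0 < q k := hpos P a hP ha
  have hmain := measured_relEntropy_le hP hQ hQ' hR hR' (fun i => hc.trans_le (ha i))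
    (fun i => hc.trans_le (hw i)) hp0 hq0 (fun _ => rfl) (fun _ => rfl)
  have key : ∀ (z : Fin K → ℝ) (A : Matrix (Fin K) (Fin K) ℝ) (b : Fin K → ℝ),
      (rotDiag A b * rotDiag R z).trace = ∑ k, z k * ∑ j, b j * ((Rᵀ * A) k j) ^ 2 := by
    intro z A b
    rw [Matrix.trace_mul_comm, trace_rotDiag_mul_rotDiag]
    refine Finset.sum_congr rfl fun k _ => ?_
    rw [Finset.mul_sum]
    exact Finset.sum_congr rfl fun j _ => by ring
  have e1 : (rotDiag Q w * matLog (rotDiag Q w)).trace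
      - (rotDiag Q w * matLog (rotDiag P a)).trace
      = ∑ i, ∑ j, w j * (Real.log (w j) - Real.log (a i)) * ((Pᵀ * Q) i j) ^ 2 := by
    rw [hWl, hAl, rotDiag_mul hQ', trace_rotDiag_eq_right hP hQ',
      Matrix.trace_mul_comm, trace_rotDiag_mul_rotDiag]
    simp only [← Finset.sum_sub_distrib]
    exact Finset.sum_congr rfl fun i _ => Finset.sum_congr rfl fun j _ => by ring
  have e2 : (rotDiag Q w * matLog (rotDiag R m)).trace = ∑ k, Real.log (m k) * p k := by
    rw [hMl, key]
  have e3 : (rotDiag P a * rotDiag R m).trace = ∑ k, m k * q k := key _ _ _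
  have e4 : (rotDiag Q w).trace = ∑ k, p k := by
    have := key (fun _ => 1) Q w
    rw [rotDiag_one hR, Matrix.mul_one] at this
    simpa using this
  rw [e1, e2, e3, e4]
  have hcl : ∑ k, p k - ∑ k, m k * q k
      ≤ ∑ k, p k * (Real.log (p k) - Real.log (q k)) - ∑ k, Real.log (m k) * p k := by
    rw [← Finset.sum_sub_distrib, ← Finset.sum_sub_distrib]
    refine Finset.sum_le_sum fun k _ => ?_
    have hmk : 0 < m k := hd.trans_le (hm k)
    have hpk := hp0 k
    have hqk := hq0 k
    have h := Real.log_le_sub_one_of_pos (div_pos (mul_pos hmk hqk) hpk)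
    rw [Real.log_div (mul_pos hmk hqk).ne' hpk.ne', Real.log_mul hmk.ne' hqk.ne'] at h
    have h2 := mul_le_mul_of_nonneg_left h hpk.le
    have h3 : p k * (m k * q k / p k - 1) = m k * q k - p k := by
      field_simp
    rw [h3] at h2
    linarith
  linarith

/-- The Klein inequality: the Bregman divergence is nonnegative. -/
theorem bregPsi_nonneg {K : ℕ} {A B : Matrix (Fin K) (Fin K) ℝ}
    (hA : A.IsHermitian) (hB : B.IsHermitian) {c : ℝ} (hc : 0 < c)
    (hAc : (A - c • (1 : Matrix (Fin K) (Fin K) ℝ)).PosSemidef)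
    (hBc : (B - c • (1 : Matrix (Fin K) (Fin K) ℝ)).PosSemidef) :
    0 ≤ bregPsi A B := by
  rw [bregPsi_eq]
  obtain ⟨P, a, hP, hP', rfl, hAl, ha⟩ := exists_rotDiag_of_posSemidef_sub hA hAc
  obtain ⟨Q, b, hQ, hQ', rfl, hBl, hb⟩ := exists_rotDiag_of_posSemidef_sub hB hBc
  rw [hAl, hBl, rotDiag_mul hP', trace_rotDiag_mul_rotDiag, trace_rotDiag_eq_left hP' hQ,
    trace_rotDiag_eq_left hP' hQ a, trace_rotDiag_eq_right hP hQ' b]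
  simp only [← Finset.sum_sub_distrib, ← Finset.sum_add_distrib]
  refine Finset.sum_nonneg fun i _ => Finset.sum_nonneg fun j _ => ?_
  have hai : 0 < a i := hc.trans_le (ha i)
  have hbj : 0 < b j := hc.trans_le (hb j)
  have h := Real.log_le_sub_one_of_pos (div_pos hbj hai)
  rw [Real.log_div hbj.ne' hai.ne'] at h
  have h2 := mul_le_mul_of_nonneg_left h hai.le
  have h3 : a i * (b j / a i - 1) = b j - a i := by field_simp
  rw [h3] at h2
  nlinarith [mul_nonneg (sub_nonneg.2 h2) (sq_nonneg ((Pᵀ * Q) i j))]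

theorem sub_mul_log_sub_log_le {x y c : ℝ} (hc : 0 < c) (hx : c ≤ x) (hy : c ≤ y) :
    (x - y) * (Real.log x - Real.log y) ≤ c⁻¹ * (x - y) ^ 2 := by
  have main : ∀ u v : ℝ, c ≤ v → v ≤ u →
      (u - v) * (Real.log u - Real.log v) ≤ c⁻¹ * (u - v) ^ 2 := by
    intro u v hv huv
    have hv0 := hc.trans_le hv
    have h := Real.log_le_sub_one_of_pos (div_pos (hv0.trans_le huv) hv0)
    rw [Real.log_div (hv0.trans_le huv).ne' hv0.ne'] at h
    have h1 : u / v - 1 ≤ c⁻¹ * (u - v) := by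
      have : u / v - 1 = v⁻¹ * (u - v) := by field_simp
      rw [this]
      exact mul_le_mul_of_nonneg_right (inv_anti₀ hc hv) (sub_nonneg.2 huv)
    nlinarith [mul_le_mul_of_nonneg_left (h.trans h1) (sub_nonneg.2 huv)]
  rcases le_total y x with h | h
  · exact main x y hy h
  · linarith [main y x hx h]

theorem trace_sub_mul_matLog_sub_le {K : ℕ} {A B : Matrix (Fin K) (Fin K) ℝ}
    (hA : A.IsHermitian) (hB : B.IsHermitian) {c : ℝ} (hc : 0 < c)
    (hAc : (A - c • (1 : Matrix (Fin K) (Fin K) ℝ)).PosSemidef)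
    (hBc : (B - c • (1 : Matrix (Fin K) (Fin K) ℝ)).PosSemidef) :
    ((A - B) * (matLog A - matLog B)).trace ≤ c⁻¹ * ((A - B) * (A - B)).trace := by
  obtain ⟨P, a, hP, hP', rfl, hAl, ha⟩ := exists_rotDiag_of_posSemidef_sub hA hAc
  obtain ⟨Q, b, hQ, hQ', rfl, hBl, hb⟩ := exists_rotDiag_of_posSemidef_sub hB hBc
  have key : ∀ x y : Fin K → ℝ,
      ((rotDiag P a - rotDiag Q b) * (rotDiag P x - rotDiag Q y)).trace
        = ∑ i, ∑ j, (a i - b j) * (x i - y j) * ((Pᵀ * Q) i j) ^ 2 := by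
    intro x y
    simp only [Matrix.sub_mul, Matrix.mul_sub, Matrix.trace_sub]
    rw [rotDiag_mul hP', rotDiag_mul hQ', Matrix.trace_mul_comm (rotDiag Q b),
      trace_rotDiag_mul_rotDiag, trace_rotDiag_mul_rotDiag,
      trace_rotDiag_eq_left hP' hQ, trace_rotDiag_eq_right hP hQ']
    simp only [← Finset.sum_sub_distrib]
    exact Finset.sum_congr rfl fun i _ => Finset.sum_congr rfl fun j _ => by ring
  rw [hAl, hBl, key, key]
  simp only [Finset.mul_sum]
  refine Finset.sum_le_sum fun i _ => Finset.sum_le_sum fun j _ => ?_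
  have := mul_le_mul_of_nonneg_right (sub_mul_log_sub_log_le hc (ha i) (hb j))
    (sq_nonneg ((Pᵀ * Q) i j))
  linarith

/-- The three-point inequality for a minimizer along the segment from `W` to `U`. -/
theorem bregPsi_three_point {K : ℕ} {W U A : Matrix (Fin K) (Fin K) ℝ}
    (G : Matrix (Fin K) (Fin K) ℝ) (hW : W.IsHermitian) (hU : U.IsHermitian)
    {c : ℝ} (hc : 0 < c)
    (hWc : (W - c • (1 : Matrix (Fin K) (Fin K) ℝ)).PosSemidef)
    (hUc : (U - c • (1 : Matrix (Fin K) (Fin K) ℝ)).PosSemidef)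
    (htr : U.trace = W.trace)
    (hmin : ∀ s : ℝ, 0 < s → s ≤ 1 →
      (W * G).trace + bregPsi W A
        ≤ ((W + s • (U - W)) * G).trace + bregPsi (W + s • (U - W)) A) :
    (W * G).trace + bregPsi W A + bregPsi U W ≤ (U * G).trace + bregPsi U A := by
  set X := ((U - W) * (G + matLog W - matLog A)).trace with hX
  set N := ((U - W) * (U - W)).trace with hN
  have hlin : ∀ s : ℝ, 0 < s → s ≤ 1 → 0 ≤ X + s * (c⁻¹ * N) := by
    intro s hs hs1
    have hmin' := hmin s hs hs1
    set V := W + s • (U - W) with hV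
    have hVW : V - W = s • (U - W) := by rw [hV, add_sub_cancel_left]
    have hVh : V.IsHermitian := hW.add ((hU.sub hW).smul (IsSelfAdjoint.all s))
    have hVc : (V - c • (1 : Matrix (Fin K) (Fin K) ℝ)).PosSemidef := by
      have : V - c • (1 : Matrix (Fin K) (Fin K) ℝ)
          = (1 - s) • (W - c • (1 : Matrix (Fin K) (Fin K) ℝ))
            + s • (U - c • (1 : Matrix (Fin K) (Fin K) ℝ)) := by
        rw [hV]; module
      rw [this]
      exact (hWc.smul (sub_nonneg.2 hs1)).add (hUc.smul hs.le)
    have hVt : V.trace = W.trace := by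
      rw [hV, Matrix.trace_add, Matrix.trace_smul, Matrix.trace_sub, htr]; simp
    have hK := bregPsi_nonneg hW hVh hc hWc hVc
    have hL := trace_sub_mul_matLog_sub_le hVh hW hc hVc hWc
    have hNs : ((V - W) * (V - W)).trace = s * (s * N) := by
      rw [hVW, Matrix.smul_mul, Matrix.mul_smul, Matrix.trace_smul, Matrix.trace_smul,
        smul_eq_mul, smul_eq_mul]
    have hXs : ((V - W) * (G + matLog W - matLog A)).trace = s * X := by
      rw [hVW, Matrix.smul_mul, Matrix.trace_smul, smul_eq_mul]
    rw [hNs] at hL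
    rw [bregPsi_eq] at hK
    rw [bregPsi_eq, bregPsi_eq] at hmin'
    simp only [Matrix.sub_mul, Matrix.mul_sub, Matrix.mul_add, Matrix.trace_sub,
      Matrix.trace_add] at hL hXs
    have : 0 ≤ s * (X + s * (c⁻¹ * N)) := by linarith
    exact nonneg_of_mul_nonneg_right this hs
  have hX0 : 0 ≤ X := by
    have hcont : Filter.Tendsto (fun s : ℝ => X + s * (c⁻¹ * N))
        (nhdsWithin 0 (Set.Ioi 0)) (nhds X) := by
      have : Filter.Tendsto (fun s : ℝ => X + s * (c⁻¹ * N)) (nhds 0)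
          (nhds (X + 0 * (c⁻¹ * N))) := Continuous.tendsto (by fun_prop) 0
      rw [zero_mul, add_zero] at this
      exact this.mono_left nhdsWithin_le_nhds
    refine ge_of_tendsto hcont ?_
    filter_upwards [Ioc_mem_nhdsGT (zero_lt_one' ℝ)] with s hs
    exact hlin s hs.1 hs.2
  rw [hX] at hX0
  simp only [Matrix.sub_mul, Matrix.mul_sub, Matrix.mul_add, Matrix.trace_sub,
    Matrix.trace_add] at hX0
  rw [bregPsi_eq, bregPsi_eq, bregPsi_eq]
  linarith

/-- The trace of a product of two positive semidefinite matrices is nonnegative. -/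
theorem trace_mul_nonneg_of_posSemidef {K : ℕ} {A B : Matrix (Fin K) (Fin K) ℝ}
    (hA : A.PosSemidef) (hB : B.PosSemidef) : 0 ≤ (A * B).trace := by
  obtain ⟨P, a, hP, hP', rfl, -, ha⟩ :=
    exists_rotDiag_of_posSemidef_sub (c := 0) hA.1 (by simpa using hA)
  obtain ⟨Q, b, hQ, hQ', rfl, -, hb⟩ :=
    exists_rotDiag_of_posSemidef_sub (c := 0) hB.1 (by simpa using hB)
  rw [trace_rotDiag_mul_rotDiag]
  exact Finset.sum_nonneg fun i _ => Finset.sum_nonneg fun j _ =>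
    mul_nonneg (mul_nonneg (ha i) (hb j)) (sq_nonneg _)

theorem neg_log_one_sub_le {x : ℝ} (hx : x ≤ 1 / 2) : -Real.log (1 - x) ≤ x + x ^ 2 := by
  rcases le_total x 0 with h | h
  · have h1 := Real.one_sub_inv_le_log_of_pos (show 0 < 1 - x by linarith)
    have h2 : (1 - x)⁻¹ ≤ 1 + x + x ^ 2 := by
      rw [inv_le_iff_one_le_mul₀ (by linarith)]
      nlinarith [mul_nonneg (neg_nonneg.2 h) (sq_nonneg x)]
    linarith
  · have h1 := (abs_le.1 (Real.abs_log_sub_add_sum_range_le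
      (show |x| < 1 by rw [abs_of_nonneg h]; linarith) 4)).1
    rw [abs_of_nonneg h] at h1
    simp only [Finset.sum_range_succ, Finset.sum_range_zero] at h1
    norm_num at h1
    have h2 : x ^ 5 / (1 - x) ≤ 2 * x ^ 5 := by
      rw [div_le_iff₀ (by linarith)]
      nlinarith [pow_nonneg h 5]
    have h3 : x ^ 2 ≤ 1 / 4 := by nlinarith
    have h4 : x ^ 3 ≤ 1 / 8 := by nlinarith
    nlinarith [mul_le_mul_of_nonneg_left
      (show x / 3 + x ^ 2 / 4 + 2 * x ^ 3 ≤ 1 / 2 by linarith) (sq_nonneg x)]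

/-- `tr(-U log(I - X)) ≤ tr(UX) + tr(UX²)` for `X ≤ I/2`. -/
theorem trace_neg_mul_matLog_one_sub_le {K : ℕ} {U X : Matrix (Fin K) (Fin K) ℝ}
    (hU : U.PosSemidef) (hX : X.IsHermitian)
    (hXc : ((1 - X) - (1 / 2 : ℝ) • (1 : Matrix (Fin K) (Fin K) ℝ)).PosSemidef) :
    -(U * matLog (1 - X)).trace ≤ (U * X).trace + (U * X * X).trace := by
  obtain ⟨P, u, hP, hP', rfl, -, hu⟩ :=
    exists_rotDiag_of_posSemidef_sub (c := 0) hU.1 (by simpa using hU)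
  obtain ⟨Q, m, hQ, hQ', hM, hMl, hm⟩ :=
    exists_rotDiag_of_posSemidef_sub (Matrix.isHermitian_one.sub hX) hXc
  have hXr : X = rotDiag Q (fun i => 1 - m i) := by
    have : rotDiag Q (fun i => 1 - m i) = rotDiag Q (fun _ => 1) - rotDiag Q m := by
      rw [rotDiag, rotDiag, rotDiag, ← Matrix.sub_mul, ← Matrix.mul_sub, Matrix.diagonal_sub]
    rw [this, rotDiag_one hQ, ← hM, sub_sub_cancel]
  rw [hMl, Matrix.mul_assoc, hXr, rotDiag_mul hQ', trace_rotDiag_mul_rotDiag,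
    trace_rotDiag_mul_rotDiag, trace_rotDiag_mul_rotDiag]
  simp only [← Finset.sum_neg_distrib, ← Finset.sum_add_distrib]
  refine Finset.sum_le_sum fun i _ => Finset.sum_le_sum fun j _ => ?_
  have h := neg_log_one_sub_le (x := 1 - m j) (by linarith [hm j])
  rw [sub_sub_cancel] at h
  nlinarith [mul_le_mul_of_nonneg_left h (mul_nonneg (hu i) (sq_nonneg ((Pᵀ * Q) i j)))]

/-- The Bregman divergence between density matrices is at most `-log c` when the second one
is bounded below by `c`. -/
theorem bregPsi_le {K : ℕ} {A B : Matrix (Fin K) (Fin K) ℝ}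
    (hA : A.PosSemidef) (hB : B.IsHermitian) (hAt : A.trace = 1) (hBt : B.trace = 1)
    {c : ℝ} (hc : 0 < c) (hBc : (B - c • (1 : Matrix (Fin K) (Fin K) ℝ)).PosSemidef) :
    bregPsi A B ≤ -Real.log c := by
  rw [bregPsi_eq, hAt, hBt]
  obtain ⟨P, a, hP, hP', rfl, hAl, ha⟩ :=
    exists_rotDiag_of_posSemidef_sub (c := 0) hA.1 (by simpa using hA)
  obtain ⟨Q, b, hQ, hQ', rfl, hBl, hb⟩ := exists_rotDiag_of_posSemidef_sub hB hBc
  have hsum : ∑ i, a i = 1 := by rw [← trace_rotDiag hP', hAt]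
  have h1 : (rotDiag P a * matLog (rotDiag P a)).trace ≤ 0 := by
    rw [hAl, rotDiag_mul hP', trace_rotDiag hP']
    refine Finset.sum_nonpos fun i _ => mul_nonpos_of_nonneg_of_nonpos (ha i)
      (Real.log_nonpos (ha i) ?_)
    rw [← hsum]
    exact Finset.single_le_sum (fun j _ => ha j) (Finset.mem_univ i)
  have h2 : Real.log c ≤ (rotDiag P a * matLog (rotDiag Q b)).trace := by
    have : Real.log c = ∑ i, ∑ j, a i * Real.log c * ((Pᵀ * Q) i j) ^ 2 := by
      rw [← trace_rotDiag_eq_left hP' hQ, trace_rotDiag hP', ← Finset.sum_mul, hsum, one_mul]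
    rw [this, hBl, trace_rotDiag_mul_rotDiag]
    refine Finset.sum_le_sum fun i _ => Finset.sum_le_sum fun j _ => ?_
    exact mul_le_mul_of_nonneg_right
      (mul_le_mul_of_nonneg_left (Real.log_le_log hc (hb j)) (ha i)) (sq_nonneg _)
  linarith

/-- Telescoping along a sequence with few switches. -/
theorem sum_sub_succ_le_of_switches {α : Type*} (U : ℕ → α) (F : α → ℕ → ℝ)
    {L : ℝ} {T : ℕ}
    (h0 : ∀ t ∈ Finset.Icc 1 T, ∀ s ∈ Finset.Icc 1 (T + 1), 0 ≤ F (U t) s)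
    (hL : ∀ t ∈ Finset.Icc 1 T, ∀ s ∈ Finset.Icc 1 (T + 1), F (U t) s ≤ L)
    [DecidablePred fun t => U t ≠ U (t - 1)] {n : ℕ} (hn : 1 ≤ n) (hnT : n ≤ T) :
    ∑ t ∈ Finset.Icc 1 n, (F (U t) t - F (U t) (t + 1))
      ≤ (1 + ((Finset.Icc 2 n).filter (fun t => U t ≠ U (t - 1))).card) * L
        - F (U n) (n + 1) := by
  induction n, hn using Nat.le_induction with
  | base =>
    have := hL 1 (by simp; omega) 1 (by simp)
    simp
    linarith
  | succ n hn ih =>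
    have ih := ih (by omega)
    rw [Finset.sum_Icc_succ_top (by omega)]
    have hIcc : Finset.Icc 2 (n + 1) = insert (n + 1) (Finset.Icc 2 n) := by
      ext x; simp; omega
    rw [hIcc, Finset.filter_insert]
    by_cases h : U (n + 1) = U n
    · rw [if_neg (by simpa using h)]
      rw [h] at *
      linarith
    · rw [if_pos (by simpa using h), Finset.card_insert_of_notMem (by simp)]
      have h1 := hL (n + 1) (by simp; omega) (n + 1) (by simp; omega)
      have h2 := h0 n (by simp; omega) (n + 1) (by simp; omega)
      push_cast
      linarith

/-- Mixing a density matrix with the maximally mixed state lands in the clipped spectraplex. -/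
theorem mix_mem_clippedSpectraplex {K T S : ℕ} (hK : 0 < K) (hT : 0 < T) (hST : S ≤ T)
    {U : Matrix (Fin K) (Fin K) ℝ} (hU : U ∈ spectraplex K) :
    (1 - (S : ℝ) / T) • U + ((S : ℝ) / (T * K)) • (1 : Matrix (Fin K) (Fin K) ℝ)
      ∈ clippedSpectraplex K T S := by
  have hT' : (0 : ℝ) < T := by exact_mod_cast hT
  have hK' : (0 : ℝ) < K := by exact_mod_cast hK
  have hε : (S : ℝ) / T ≤ 1 := by
    rw [div_le_one hT']; exact_mod_cast hST
  have hPS := hU.1.smul (sub_nonneg.2 hε)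
  refine ⟨hPS.add (Matrix.PosSemidef.one.smul (by positivity)), ?_, ?_⟩
  · rw [Matrix.trace_add, Matrix.trace_smul, Matrix.trace_smul, hU.2, Matrix.trace_one,
      Fintype.card_fin, smul_eq_mul, smul_eq_mul]
    field_simp
    ring
  · rwa [add_sub_cancel_right]

theorem segment_mem_clippedSpectraplex {K T S : ℕ} {W U : Matrix (Fin K) (Fin K) ℝ}
    (hW : W ∈ clippedSpectraplex K T S) (hU : U ∈ clippedSpectraplex K T S)
    {s : ℝ} (hs : 0 ≤ s) (hs1 : s ≤ 1) : W + s • (U - W) ∈ clippedSpectraplex K T S := by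
  have key : ∀ c : ℝ, W + s • (U - W) - c • (1 : Matrix (Fin K) (Fin K) ℝ)
      = (1 - s) • (W - c • (1 : Matrix (Fin K) (Fin K) ℝ))
        + s • (U - c • (1 : Matrix (Fin K) (Fin K) ℝ)) := fun c => by module
  refine ⟨?_, ?_, ?_⟩
  · have := key 0
    simp only [zero_smul, sub_zero] at this
    rw [this]
    exact (hW.1.smul (sub_nonneg.2 hs1)).add (hU.1.smul hs)
  · rw [Matrix.trace_add, Matrix.trace_smul, Matrix.trace_sub, hW.2.1, hU.2.1]; simp
  · rw [key]
    exact (hW.2.2.smul (sub_nonneg.2 hs1)).add (hU.2.2.smul hs)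

theorem specNormLeOne.one_sub_smul_sub_posSemidef {K : ℕ} {Z : Matrix (Fin K) (Fin K) ℝ}
    (hZ : specNormLeOne Z) {η : ℝ} (hη : 0 ≤ η) (hη2 : η ≤ 1 / 2) :
    ((1 - η • Z) - (1 / 2 : ℝ) • (1 : Matrix (Fin K) (Fin K) ℝ)).PosSemidef := by
  have : (1 - η • Z) - (1 / 2 : ℝ) • (1 : Matrix (Fin K) (Fin K) ℝ)
      = η • (1 - Z) + (1 / 2 - η) • (1 : Matrix (Fin K) (Fin K) ℝ) := by module
  rw [this]
  exact (hZ.2.1.smul hη).add (Matrix.PosSemidef.one.smul (sub_nonneg.2 hη2))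

theorem specNormLeOne.neg_trace_le {K : ℕ} {U Z : Matrix (Fin K) (Fin K) ℝ}
    (hZ : specNormLeOne Z) (hU : U.PosSemidef) : -U.trace ≤ (U * Z).trace := by
  have := trace_mul_nonneg_of_posSemidef hU hZ.2.2
  rw [Matrix.mul_add, Matrix.mul_one, Matrix.trace_add] at this
  linarith

theorem specNormLeOne.trace_mul_le {K : ℕ} {U Z : Matrix (Fin K) (Fin K) ℝ}
    (hZ : specNormLeOne Z) (hU : U.PosSemidef) : (U * Z).trace ≤ U.trace := by
  have := trace_mul_nonneg_of_posSemidef hU hZ.2.1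
  rw [Matrix.mul_sub, Matrix.mul_one, Matrix.trace_sub] at this
  linarith

theorem specNormLeOne.posSemidef_sq {K : ℕ} {Z : Matrix (Fin K) (Fin K) ℝ}
    (hZ : specNormLeOne Z) : (Z * Z).PosSemidef := by
  have := Matrix.posSemidef_conjTranspose_mul_self Z
  rwa [hZ.1.eq] at this

theorem specNormLeOne.trace_sq_le {K : ℕ} {Z : Matrix (Fin K) (Fin K) ℝ}
    (hZ : specNormLeOne Z) : (Z * Z).trace ≤ K := by
  have h := trace_mul_nonneg_of_posSemidef hZ.2.1 hZ.2.2
  have e : (1 - Z) * (1 + Z) = 1 - Z * Z := by noncomm_ring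
  rw [e, Matrix.trace_sub, Matrix.trace_one, Fintype.card_fin] at h
  linarith

/-- One step of the algorithm against a comparator in the clipped spectraplex. -/
theorem pcsp_step {K T S : ℕ} (hK : 0 < K) (hT : 0 < T) (hS : 0 < S)
    {η : ℝ} (hη : 0 ≤ η) (hη2 : η ≤ 1 / 2) {Z W W' V : Matrix (Fin K) (Fin K) ℝ}
    (hZ : specNormLeOne Z) (hW : W ∈ clippedSpectraplex K T S)
    (hW' : W' ∈ clippedSpectraplex K T S) (hV : V ∈ clippedSpectraplex K T S)
    (hmin : ∀ X ∈ clippedSpectraplex K T S,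
      (-(W' * matLog (1 - η • Z))).trace + bregPsi W' W
        ≤ (-(X * matLog (1 - η • Z))).trace + bregPsi X W) :
    η * (W * Z).trace
      ≤ η * (V * Z).trace + η ^ 2 * (V * Z * Z).trace + (bregPsi V W - bregPsi V W') := by
  have hc : (0 : ℝ) < (S : ℝ) / (T * K) := by positivity
  have hM := hZ.one_sub_smul_sub_posSemidef hη hη2
  have hXh : (η • Z).IsHermitian := hZ.1.smul (IsSelfAdjoint.all η)
  have h1 := trace_sub_trace_mul_le hW'.1.1 hW.1.1 (Matrix.isHermitian_one.sub hXh) hc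
    one_half_pos hW'.2.2 hW.2.2 hM
  have h2 := bregPsi_three_point (A := W) (-matLog (1 - η • Z)) hW'.1.1 hV.1.1 hc hW'.2.2
    hV.2.2 (hV.2.1.trans hW'.2.1.symm) (fun s hs hs1 => by
      simpa only [Matrix.mul_neg] using
        hmin _ (segment_mem_clippedSpectraplex hW' hV hs.le hs1))
  have h3 := trace_neg_mul_matLog_one_sub_le hV.1 hXh hM
  have h4 := bregPsi_eq W' W
  rw [hW.2.1, hW'.2.1] at h4
  rw [hW'.2.1, Matrix.mul_sub, Matrix.mul_one, Matrix.trace_sub, hW.2.1, Matrix.mul_smul,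
    Matrix.trace_smul, smul_eq_mul] at h1
  simp only [Matrix.mul_neg, Matrix.trace_neg] at h2
  simp only [Matrix.mul_smul, Matrix.smul_mul, Matrix.trace_smul, smul_eq_mul] at h3
  linarith

/-- The cost of replacing a comparator by its mixture with the maximally mixed state. -/
theorem mix_loss_le {K T S : ℕ} (hK : 0 < K) (hT : 0 < T)
    {η : ℝ} (hη : 0 ≤ η) (hη2 : η ≤ 1 / 2) {Z U : Matrix (Fin K) (Fin K) ℝ}
    (hZ : specNormLeOne Z) (hU : U ∈ spectraplex K) :
    η * (((1 - (S : ℝ) / T) • U + ((S : ℝ) / (T * K)) • (1 : Matrix (Fin K) (Fin K) ℝ))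
          * Z).trace
        + η ^ 2 * (((1 - (S : ℝ) / T) • U
          + ((S : ℝ) / (T * K)) • (1 : Matrix (Fin K) (Fin K) ℝ)) * Z * Z).trace
      ≤ η * (U * Z).trace + η ^ 2 * (U * Z * Z).trace + η * (5 / 2 * (S / T)) := by
  have hK' : (0 : ℝ) < K := by exact_mod_cast hK
  have hT' : (0 : ℝ) < T := by exact_mod_cast hT
  have hε : (0 : ℝ) ≤ (S : ℝ) / T := by positivity
  have hεK : (S : ℝ) / (T * K) = (S : ℝ) / T * (1 / K) := by field_simp
  simp only [Matrix.add_mul, Matrix.smul_mul, Matrix.one_mul, Matrix.trace_add,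
    Matrix.trace_smul, smul_eq_mul]
  have h1 := hZ.neg_trace_le hU.1
  have h2 : 0 ≤ (U * Z * Z).trace := by
    rw [Matrix.mul_assoc]; exact trace_mul_nonneg_of_posSemidef hU.1 hZ.posSemidef_sq
  have h3 := hZ.trace_mul_le Matrix.PosSemidef.one
  have h4 := hZ.trace_sq_le
  rw [Matrix.one_mul, Matrix.trace_one, Fintype.card_fin] at h3
  rw [hU.2] at h1
  have h3' : 1 / (K : ℝ) * Z.trace ≤ 1 := by
    rw [one_div, inv_mul_le_one₀ hK']; exact h3
  have h4' : 1 / (K : ℝ) * (Z * Z).trace ≤ 1 := by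
    rw [one_div, inv_mul_le_one₀ hK']; exact h4
  rw [hεK]
  set ε := (S : ℝ) / T
  set z := 1 / (K : ℝ) * Z.trace
  set zz := 1 / (K : ℝ) * (Z * Z).trace
  have hfac : η * (z - (U * Z).trace) + η ^ 2 * (zz - (U * Z * Z).trace) ≤ η * (5 / 2) := by
    have a1 : η * (z - (U * Z).trace) ≤ η * 2 :=
      mul_le_mul_of_nonneg_left (by linarith) hη
    have a2 : η ^ 2 * (zz - (U * Z * Z).trace) ≤ η ^ 2 * 1 :=
      mul_le_mul_of_nonneg_left (by linarith) (sq_nonneg η)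
    nlinarith
  have := mul_le_mul_of_nonneg_left hfac hε
  linarith

theorem pcsp_second_order_tracking_regret
    (K T S : ℕ) (hK : 0 < K) (hT : 0 < T) (hS : 0 < S) (hST : S ≤ T)
    (η : ℝ) (hη : 0 < η) (hη2 : η ≤ 1 / 2)
    (Z : ℕ → Matrix (Fin K) (Fin K) ℝ)
    (hZ : ∀ t ∈ Finset.Icc 1 T, specNormLeOne (Z t))
    (W : ℕ → Matrix (Fin K) (Fin K) ℝ)
    (hW1 : W 1 ∈ clippedSpectraplex K T S)
    (hmin : ∀ t ∈ Finset.Icc 1 T,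
      W (t + 1) ∈ clippedSpectraplex K T S ∧
      ∀ V ∈ clippedSpectraplex K T S,
        (-(W (t + 1) * matLog (1 - η • Z t))).trace + bregPsi (W (t + 1)) (W t)
          ≤ (-(V * matLog (1 - η • Z t))).trace + bregPsi V (W t))
    (U : ℕ → Matrix (Fin K) (Fin K) ℝ)
    (hU : ∀ t ∈ Finset.Icc 1 T, U t ∈ spectraplex K)
    (hSw : ((Finset.Icc 2 T).filter (fun t => U t ≠ U (t - 1))).card ≤ S - 1) :
    ∑ t ∈ Finset.Icc 1 T, (W t * Z t).trace - ∑ t ∈ Finset.Icc 1 T, (U t * Z t).trace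
      ≤ η * ∑ t ∈ Finset.Icc 1 T, (U t * Z t * Z t).trace
        + S * Real.log (K * T / S) / η + 5 * S / 2 := by
  have hc : (0 : ℝ) < (S : ℝ) / (T * K) := by positivity
  have hT' : (0 : ℝ) < T := by exact_mod_cast hT
  have hWmem : ∀ t ∈ Finset.Icc 1 (T + 1), W t ∈ clippedSpectraplex K T S := by
    intro t ht
    rw [Finset.mem_Icc] at ht
    rcases Nat.eq_or_lt_of_le ht.1 with h | h
    · rwa [← h]
    · have := (hmin (t - 1) (by rw [Finset.mem_Icc]; omega)).1
      rwa [Nat.sub_add_cancel (by omega)] at this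
  set mix : Matrix (Fin K) (Fin K) ℝ → Matrix (Fin K) (Fin K) ℝ := fun V =>
    (1 - (S : ℝ) / T) • V + ((S : ℝ) / (T * K)) • (1 : Matrix (Fin K) (Fin K) ℝ) with hmix
  have hmixmem : ∀ t ∈ Finset.Icc 1 T, mix (U t) ∈ clippedSpectraplex K T S :=
    fun t ht => mix_mem_clippedSpectraplex hK hT hST (hU t ht)
  set L := Real.log (K * T / S) with hL
  have hLc : -Real.log ((S : ℝ) / (T * K)) = L := by
    rw [← Real.log_inv, inv_div, mul_comm]
  have hb0 : ∀ t ∈ Finset.Icc 1 T, ∀ s ∈ Finset.Icc 1 (T + 1),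
      0 ≤ bregPsi (mix (U t)) (W s) := fun t ht s hs =>
    bregPsi_nonneg (hmixmem t ht).1.1 (hWmem s hs).1.1 hc (hmixmem t ht).2.2 (hWmem s hs).2.2
  have hbL : ∀ t ∈ Finset.Icc 1 T, ∀ s ∈ Finset.Icc 1 (T + 1),
      bregPsi (mix (U t)) (W s) ≤ L := fun t ht s hs =>
    hLc ▸ bregPsi_le (hmixmem t ht).1 (hWmem s hs).1.1 (hmixmem t ht).2.1 (hWmem s hs).2.1 hc
      (hWmem s hs).2.2
  have hL0 : 0 ≤ L :=
    (hb0 1 (by simp; omega) 1 (by simp)).trans (hbL 1 (by simp; omega) 1 (by simp))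
  have htel := sum_sub_succ_le_of_switches U (fun V s => bregPsi (mix V) (W s)) hb0 hbL hT le_rfl
  have hend := hb0 T (by simp; omega) (T + 1) (by simp)
  have hcard : (1 + (((Finset.Icc 2 T).filter (fun t => U t ≠ U (t - 1))).card : ℝ)) * L
      ≤ S * L := by
    refine mul_le_mul_of_nonneg_right ?_ hL0
    have : 1 + ((Finset.Icc 2 T).filter (fun t => U t ≠ U (t - 1))).card ≤ S := by omega
    exact_mod_cast this
  have hstep : ∀ t ∈ Finset.Icc 1 T, η * (W t * Z t).trace
      ≤ η * (U t * Z t).trace + η ^ 2 * (U t * Z t * Z t).trace + η * (5 / 2 * (S / T))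
        + (bregPsi (mix (U t)) (W t) - bregPsi (mix (U t)) (W (t + 1))) := by
    intro t ht
    have h1 := pcsp_step hK hT hS hη.le hη2 (hZ t ht)
      (hWmem t (by rw [Finset.mem_Icc] at ht ⊢; omega)) (hmin t ht).1 (hmixmem t ht) (hmin t ht).2
    have h2 := mix_loss_le (S := S) hK hT hη.le hη2 (hZ t ht) (hU t ht)
    linarith
  have hsum := Finset.sum_le_sum hstep
  simp only [Finset.sum_add_distrib, ← Finset.mul_sum, Finset.sum_const, Nat.card_Icc,
    Nat.add_sub_cancel, nsmul_eq_mul] at hsum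
  have hconst : (T : ℝ) * (5 / 2 * (S / T)) = 5 * S / 2 := by field_simp
  have hfin : η * (∑ t ∈ Finset.Icc 1 T, (W t * Z t).trace
        - ∑ t ∈ Finset.Icc 1 T, (U t * Z t).trace)
      ≤ η * (η * ∑ t ∈ Finset.Icc 1 T, (U t * Z t * Z t).trace + S * L / η + 5 * S / 2) := by
    have : η * (S * L / η) = S * L := by field_simp
    rw [mul_add, mul_add, this]
    have h5 : (T : ℝ) * (η * (5 / 2 * (S / T))) = η * (5 * S / 2) := by rw [← hconst]; ring
    linarith
  exact le_of_mul_le_mul_left hfin hη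
end

section
/- Let K, T, S be positive integers with S ≤ T, let η > 0, let ℓ ∈ [0,1]^K, and let w be an element of the clipped simplex Δ̃_K. Let w' be the minimizer over Δ̃_K of v ↦ ⟨v, ηℓ⟩ + D_φ(v‖w). Then ⟨w − w', ℓ⟩ ≤ η. -/
open Finset

/-- Pointwise form of the comparison between relative entropy and squared Hellinger distance. -/
theorem sq_sqrt_sub_sqrt_le_kl {x y : ℝ} (hx : 0 < x) (hy : 0 < y) :
    (√x - √y) ^ 2 ≤ x * Real.log x - y * Real.log y - (x - y) * (1 + Real.log y) := by
  have ha : 0 < √x := Real.sqrt_pos.2 hx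
  have hb : 0 < √y := Real.sqrt_pos.2 hy
  have hxa : √x ^ 2 = x := Real.sq_sqrt hx.le
  have hyb : √y ^ 2 = y := Real.sq_sqrt hy.le
  generalize √x = a at *
  generalize √y = b at *
  subst hxa hyb
  have h := Real.log_le_sub_one_of_pos (div_pos hb ha)
  rw [Real.log_div hb.ne' ha.ne'] at h
  have h' := mul_le_mul_of_nonneg_left h (sq_nonneg a)
  have e : a ^ 2 * (b / a - 1) = a * b - a ^ 2 := by field_simp
  rw [e] at h'
  rw [Real.log_pow, Real.log_pow]
  push_cast
  nlinarith

/-- The Bregman divergence of the negative entropy dominates the squared Hellinger distance. -/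
theorem sum_sq_sqrt_sub_sqrt_le_breg {K : ℕ} {x y : Fin K → ℝ}
    (hx : ∀ i, 0 < x i) (hy : ∀ i, 0 < y i) :
    ∑ i, (√(x i) - √(y i)) ^ 2 ≤ breg x y := by
  unfold breg negEntropy
  rw [← Finset.sum_sub_distrib, ← Finset.sum_sub_distrib]
  exact Finset.sum_le_sum fun i _ => sq_sqrt_sub_sqrt_le_kl (hx i) (hy i)

/-- A Pinsker-type inequality for test vectors with entries in `[0, 1]`. -/
theorem sq_ip_sub_le_breg {K : ℕ} {x y ℓ : Fin K → ℝ}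
    (hx : ∀ i, 0 < x i) (hy : ∀ i, 0 < y i) (hxs : ∑ i, x i = 1) (hys : ∑ i, y i = 1)
    (hℓ : ∀ i, ℓ i ∈ Set.Icc (0 : ℝ) 1) :
    ip (y - x) ℓ ^ 2 ≤ breg x y := by
  have hcenter : ip (y - x) ℓ =
      ∑ i, (√(x i) - √(y i)) * ((1 / 2 - ℓ i) * (√(x i) + √(y i))) := by
    have h0 : ∑ i, (x i - y i) * (1 / 2) = 0 := by
      rw [← Finset.sum_mul, Finset.sum_sub_distrib, hxs, hys]; simp
    rw [ip, ← add_zero (∑ i, _), ← h0, ← Finset.sum_add_distrib]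
    refine Finset.sum_congr rfl fun i _ => ?_
    have h1 := Real.sq_sqrt (hx i).le
    have h2 := Real.sq_sqrt (hy i).le
    simp only [Pi.sub_apply]
    linear_combination (ℓ i - 1 / 2) * h1 - (ℓ i - 1 / 2) * h2
  have hweight : ∑ i, ((1 / 2 - ℓ i) * (√(x i) + √(y i))) ^ 2 ≤ 1 := by
    calc ∑ i, ((1 / 2 - ℓ i) * (√(x i) + √(y i))) ^ 2
        ≤ ∑ i, (x i + y i) / 2 := by
          refine Finset.sum_le_sum fun i _ => ?_
          have h1 := Real.sq_sqrt (hx i).le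
          have h2 := Real.sq_sqrt (hy i).le
          obtain ⟨hl, hu⟩ := hℓ i
          have h3 : (1 / 2 - ℓ i) ^ 2 ≤ 1 / 4 := by nlinarith
          rw [mul_pow]
          have h4 := mul_le_mul_of_nonneg_right h3 (sq_nonneg (√(x i) + √(y i)))
          nlinarith [sq_nonneg (√(x i) - √(y i))]
      _ = 1 := by
          rw [← Finset.sum_div, Finset.sum_add_distrib, hxs, hys]; norm_num
  have hH : 0 ≤ ∑ i, (√(x i) - √(y i)) ^ 2 := Finset.sum_nonneg fun i _ => sq_nonneg _
  calc ip (y - x) ℓ ^ 2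
      ≤ (∑ i, (√(x i) - √(y i)) ^ 2) * ∑ i, ((1 / 2 - ℓ i) * (√(x i) + √(y i))) ^ 2 := by
        rw [hcenter]
        exact Finset.sum_mul_sq_le_sq_mul_sq _ _ _
    _ ≤ ∑ i, (√(x i) - √(y i)) ^ 2 := mul_le_of_le_one_right hH hweight
    _ ≤ breg x y := sum_sq_sqrt_sub_sqrt_le_breg hx hy

/-- Entries of vectors in the clipped simplex are positive. -/
theorem pos_of_mem_clippedSimplex {K T S : ℕ} (hK : 0 < K) (hT : 0 < T) (hS : 0 < S)
    {w : Fin K → ℝ} (hw : w ∈ clippedSimplex K T S) (i : Fin K) : 0 < w i :=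
  lt_of_lt_of_le (by positivity) (hw.2 i)

theorem omd_one_step_loss_difference_bound
    (K T S : ℕ) (hK : 0 < K) (hT : 0 < T) (hS : 0 < S) (hST : S ≤ T)
    (η : ℝ) (hη : 0 < η)
    (ℓ : Fin K → ℝ) (hℓ : ∀ i, ℓ i ∈ Set.Icc (0 : ℝ) 1)
    (w : Fin K → ℝ) (hw : w ∈ clippedSimplex K T S)
    (w' : Fin K → ℝ)
    (hw' : w' ∈ clippedSimplex K T S ∧
      ∀ v ∈ clippedSimplex K T S,
        ip w' (η • ℓ) + breg w' w ≤ ip v (η • ℓ) + breg v w) :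
    ip (w - w') ℓ ≤ η := by
  have hpinsker := sq_ip_sub_le_breg (pos_of_mem_clippedSimplex hK hT hS hw'.1)
    (pos_of_mem_clippedSimplex hK hT hS hw) hw'.1.1.2 hw.1.2 hℓ
  have hopt := hw'.2 w hw
  have hself : breg w w = 0 := by simp [breg]
  have hlin : ip w (η • ℓ) - ip w' (η • ℓ) = η * ip (w - w') ℓ := by
    simp only [ip, Pi.smul_apply, Pi.sub_apply, smul_eq_mul]
    rw [← Finset.sum_sub_distrib, Finset.mul_sum]
    exact Finset.sum_congr rfl fun i _ => by ring
  by_contra! hlt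
  nlinarith
end
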